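/- Let Γ be a discrete group, G a Γ-graded Hausdorff ample groupoid, R a commutative ring with identity, and let π=(π_B, C_R(BB⁻¹), C_R(G⁰))_{B∈G^h} be the induced action of the inverse semigroup G^h of homogeneous compact open bisections on C_R(G⁰), where π_B(f)=f∘π_{B⁻¹} and π_B : d(B)→r(B) is given by u↦r(Bu). Then there is a Γ-graded R-algebra isomorphism A_R(G) ≅ C_R(G⁰) ⋊_π G^h, determined by 1_D ↦ [1_{r(D)}δ_D] for each homogeneous compact open bisection D. -/

import Mathlib

open Set Function

/-- A groupoid structure on a type `G`: a small category in which every morphism is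
invertible, encoded with a total multiplication `mul` that is only meaningful on
composable pairs.  Here `d x = x⁻¹x` and `r x = xx⁻¹`, and a pair `(x, y)` is
composable exactly when `d x = r y`. -/
structure GroupoidStr (G : Type*) where
  mul : G → G → G
  inv : G → G
  inv_inv : ∀ x, inv (inv x) = x
  /-- `x · d x = x` -/
  mul_d : ∀ x, mul x (mul (inv x) x) = x
  /-- `r x · x = x` -/
  r_mul : ∀ x, mul (mul x (inv x)) x = x
  /-- associativity on composable pairs -/
  assoc : ∀ x y z, mul (inv x) x = mul y (inv y) → mul (inv y) y = mul z (inv z) →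
    mul (mul x y) z = mul x (mul y z)
  /-- `d (xy) = d y` for composable `x, y` -/
  d_comp : ∀ x y, mul (inv x) x = mul y (inv y) →
    mul (inv (mul x y)) (mul x y) = mul (inv y) y
  /-- `r (xy) = r x` for composable `x, y` -/
  r_comp : ∀ x y, mul (inv x) x = mul y (inv y) →
    mul (mul x y) (inv (mul x y)) = mul x (inv x)
  /-- `(xy)⁻¹ = y⁻¹x⁻¹` for composable `x, y` -/
  inv_mul : ∀ x y, mul (inv x) x = mul y (inv y) → inv (mul x y) = mul (inv y) (inv x)
  /-- units are their own inverses -/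
  unit_self_inv : ∀ x, inv (mul (inv x) x) = mul (inv x) x
  /-- units are idempotents -/
  unit_idem : ∀ x, mul (mul (inv x) x) (mul (inv x) x) = mul (inv x) x

namespace GroupoidStr

variable {G : Type*} (S : GroupoidStr G)

/-- The domain (source) `d x = x⁻¹ x` of `x`. -/
def d (x : G) : G := S.mul (S.inv x) x

/-- The range `r x = x x⁻¹` of `x`. -/
def r (x : G) : G := S.mul x (S.inv x)

/-- The unit space `G⁰ = d(G) = r(G)`. -/
def unitSpace : Set G := Set.range S.d

/-- The isotropy bundle `Iso(G) = {x | d x = r x}`. -/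
def IsoSet : Set G := {x | S.d x = S.r x}

/-- The orbit of a unit `u`: `{r γ : d γ = u}`. -/
def orbit (u : G) : Set G := S.r '' {γ : G | S.d γ = u}

/-- A subset `U` of the unit space is invariant if `d γ ∈ U` implies `r γ ∈ U`. -/
def IsInvariant (U : Set G) : Prop := ∀ γ : G, S.d γ ∈ U → S.r γ ∈ U

section Top

variable [TopologicalSpace G]

/-- `G` is a topological groupoid: inversion and composition (on the set of composable
pairs, with the relative product topology) are continuous. -/
def IsTopological : Prop :=
  Continuous S.inv ∧
    Continuous fun p : {p : G × G // S.d p.1 = S.r p.2} => S.mul p.1.1 p.1.2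

/-- An open bisection: an open set on which both `d` and `r` restrict to homeomorphisms
onto open subsets of the unit space. -/
def IsOpenBisection (U : Set G) : Prop :=
  IsOpen U ∧ Set.InjOn S.d U ∧ Set.InjOn S.r U ∧
    (∀ V ⊆ U, IsOpen V → IsOpen (S.d '' V)) ∧ (∀ V ⊆ U, IsOpen V → IsOpen (S.r '' V))

/-- An étale groupoid: there is a basis of open bisections (equivalently, `d` is a local
homeomorphism). -/
def IsEtale : Prop := ∀ x : G, ∃ U, x ∈ U ∧ S.IsOpenBisection U

/-- An ample groupoid: there is a basis of compact open bisections. -/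
def IsAmple : Prop :=
  ∀ (x : G) (W : Set G), x ∈ W → IsOpen W →
    ∃ U, x ∈ U ∧ U ⊆ W ∧ IsCompact U ∧ S.IsOpenBisection U

def IsCompactOpenBisection (U : Set G) : Prop := IsCompact U ∧ S.IsOpenBisection U

/-- `G` is effective if the interior of the isotropy bundle is the unit space. -/
def IsEffective : Prop := interior S.IsoSet = S.unitSpace

variable (R : Type*) [CommRing R]

/-- The underlying set of the Steinberg algebra `A_R(G)`: locally constant,
compactly supported `R`-valued functions on `G`.  (The groupoid structure argument is
only used for the `A_R(G)` notation `S.SteinSet R`.) -/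
def SteinSet (_Sg : GroupoidStr G) : Set (G → R) :=
  {f | IsLocallyConstant f ∧ HasCompactSupport f}

variable {R}

/-- Convolution: `(f * g) γ = ∑_{αβ = γ} f α * g β`. -/
noncomputable def conv (f g : G → R) : G → R := fun γ =>
  ∑ᶠ p ∈ {p : G × G | S.d p.1 = S.r p.2 ∧ S.mul p.1 p.2 = γ}, f p.1 * g p.2

end Top

end GroupoidStr

namespace GroupoidStr

variable {G : Type*} (S : GroupoidStr G)

/-- Product of subsets of a groupoid: `UV = {uv : u ∈ U, v ∈ V, d u = r v}`. -/
def setMul (U V : Set G) : Set G :=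
  {z : G | ∃ u ∈ U, ∃ v ∈ V, S.d u = S.r v ∧ z = S.mul u v}

/-- The inverse `U⁻¹ = {u⁻¹ : u ∈ U}` of a subset of a groupoid. -/
def invSet (B : Set G) : Set G := S.inv '' B

/-- The partial homeomorphism `π_B : d(B) → r(B)`, `u ↦ r(Bu)` of the unit space
associated to a bisection `B` (extended by the identity off `d(B)`). -/
noncomputable def piMap (B : Set G) (u : G) : G :=
  letI := Classical.propDecidable
  if h : ∃ b ∈ B, S.d b = u then S.r h.choose else u

variable {R : Type*} [CommRing R]

/-- The induced map `π_B` on functions: `π_B(f) = f ∘ π_B⁻¹ = f ∘ π_{B⁻¹}`, an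
isomorphism `C_R(B⁻¹B) → C_R(BB⁻¹)` (realized on functions supported in `r(B)`). -/
noncomputable def actOn (B : Set G) (f : G → R) : G → R :=
  (S.r '' B).indicator fun u => f (S.piMap (S.invSet B) u)

variable {Γ : Type*} (c : G → Γ)

/-- A homogeneous compact open bisection (an element of the inverse semigroup `G^h`). -/
def IsHomCOB [TopologicalSpace G] (B : Set G) : Prop :=
  S.IsCompactOpenBisection B ∧ ∃ γ : Γ, B ⊆ c ⁻¹' {γ}

/-- `a` is a legitimate coefficient for `δ_B`: an element of the ideal
`C_R(BB⁻¹) ⊆ C_R(G⁰)`. -/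
def coeffOK [TopologicalSpace G] (B : Set G) (a : G → R) : Prop :=
  a ∈ S.SteinSet R ∧ ∀ x : G, a x ≠ 0 → x ∈ S.r '' B

/-- The formal element `a δ_B` of the skew inverse semigroup ring `L`. -/
noncomputable def deltaEl (_Sg : GroupoidStr G) (B : Set G) (a : G → R) : Set G → G → R :=
  fun C => letI := Classical.propDecidable; if C = B then a else 0

/-- The underlying set of `L = {∑ a_B δ_B : a_B ∈ C_R(BB⁻¹), B ∈ G^h}`. -/
def LSet [TopologicalSpace G] : Set (Set G → G → R) :=
  {F | {B : Set G | F B ≠ 0}.Finite ∧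
    ∀ B : Set G, F B ≠ 0 → S.IsHomCOB c B ∧ S.coeffOK B (F B)}

/-- The multiplication of `L`: `(a_B δ_B)(a_D δ_D) = π_B(π_{B⁻¹}(a_B) a_D) δ_{BD}`. -/
noncomputable def skewMul (F F' : Set G → G → R) : Set G → G → R :=
  fun C => ∑ᶠ p ∈ {p : Set G × Set G | S.setMul p.1 p.2 = C},
    S.actOn p.1 (S.actOn (S.invSet p.1) (F p.1) * F' p.2)

/-- Generators `a δ_B − a δ_C`, for `B ≤ C` (i.e. `B ⊆ C`) and `a ∈ C_R(BB⁻¹)`, of the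
ideal `N` of `L`. -/
def relGen [TopologicalSpace G] : Set (Set G → G → R) :=
  {F | ∃ (B C : Set G) (a : G → R), B ⊆ C ∧ S.IsHomCOB c B ∧ S.IsHomCOB c C ∧
    S.coeffOK B a ∧ F = S.deltaEl B a - S.deltaEl C a}

/-- The ideal `N` of `L` generated by the elements `a δ_B − a δ_C` (`B ≤ C`), so that
`C_R(G⁰) ⋊_π G^h = L / N`. -/
def NSet [TopologicalSpace G] : Set (Set G → G → R) :=
  ↑(AddSubgroup.closure
    {F | ∃ g ∈ S.relGen c, F = g ∨ (∃ X ∈ S.LSet c, F = S.skewMul X g) ∨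
      (∃ Y ∈ S.LSet c, F = S.skewMul g Y) ∨
      (∃ X ∈ S.LSet c, ∃ Y ∈ S.LSet c, F = S.skewMul (S.skewMul X g) Y)} :
    AddSubgroup (Set G → G → R))

end GroupoidStr

/-- The additive group of finitely supported families whose support consists of indices
satisfying `P`. -/
def finSuppOn {ι M : Type*} [AddCommGroup M] (P : ι → Prop) : AddSubgroup (ι → M) where
  carrier := {F | (support F).Finite ∧ ∀ i, F i ≠ 0 → P i}
  zero_mem' := by simp
  add_mem' := by
    rintro F F' ⟨hF, hP⟩ ⟨hF', hP'⟩
    refine ⟨(hF.union hF').subset (support_add F F'), fun i hi => ?_⟩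
    by_cases h : F i = 0
    · exact hP' i fun h' => hi (by simp [h, h'])
    · exact hP i h
  neg_mem' := by
    rintro F ⟨hF, hP⟩
    exact ⟨by simpa [support_neg] using hF, fun i hi => hP i (by simpa using hi)⟩

namespace GroupoidStr

section Algebra

variable {G : Type*} (S : GroupoidStr G) {R : Type*} [CommRing R]

theorem d_inv (x : G) : S.d (S.inv x) = S.r x := by
  simp only [d, r, S.inv_inv]

theorem r_inv (x : G) : S.r (S.inv x) = S.d x := by
  simp only [d, r, S.inv_inv]

theorem d_mul {x y : G} (h : S.d x = S.r y) : S.d (S.mul x y) = S.d y := S.d_comp x y h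

theorem r_mul' {x y : G} (h : S.d x = S.r y) : S.r (S.mul x y) = S.r x := S.r_comp x y h

/-- A set on which both `d` and `r` are injective. -/
def IsBisection (B : Set G) : Prop := InjOn S.d B ∧ InjOn S.r B

variable {S}

theorem IsBisection.setMul {B D : Set G} (hB : S.IsBisection B) (hD : S.IsBisection D) :
    S.IsBisection (S.setMul B D) := by
  constructor
  · rintro _ ⟨u, hu, v, hv, huv, rfl⟩ _ ⟨u', hu', v', hv', huv', rfl⟩ h
    rw [S.d_mul huv, S.d_mul huv'] at h
    obtain rfl := hD.1 hv hv' h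
    rw [hB.1 hu hu' (huv.trans huv'.symm)]
  · rintro _ ⟨u, hu, v, hv, huv, rfl⟩ _ ⟨u', hu', v', hv', huv', rfl⟩ h
    rw [S.r_mul' huv, S.r_mul' huv'] at h
    obtain rfl := hB.2 hu hu' h
    rw [hD.2 hv hv' (huv.symm.trans huv')]

variable (S)

theorem piMap_d {B : Set G} (hB : InjOn S.d B) {b : G} (hb : b ∈ B) :
    S.piMap B (S.d b) = S.r b := by
  have h : ∃ b' ∈ B, S.d b' = S.d b := ⟨b, hb, rfl⟩
  rw [piMap, dif_pos h, hB h.choose_spec.1 hb h.choose_spec.2]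

theorem injOn_d_invSet {B : Set G} (hB : InjOn S.r B) : InjOn S.d (S.invSet B) := by
  rintro _ ⟨x, hx, rfl⟩ _ ⟨y, hy, rfl⟩ h
  rw [d_inv, d_inv] at h
  rw [hB hx hy h]

theorem invSet_invSet (B : Set G) : S.invSet (S.invSet B) = B := by
  simp [invSet, image_image, S.inv_inv]

theorem actOn_r {B : Set G} (hB : InjOn S.r B) {b : G} (hb : b ∈ B) (f : G → R) :
    S.actOn B f (S.r b) = f (S.d b) := by
  rw [actOn, indicator_of_mem (mem_image_of_mem _ hb), ← S.d_inv,
    S.piMap_d (S.injOn_d_invSet hB) (mem_image_of_mem _ hb), r_inv]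

theorem actOn_invSet_d {B : Set G} (hB : InjOn S.d B) {b : G} (hb : b ∈ B) (f : G → R) :
    S.actOn (S.invSet B) f (S.d b) = f (S.r b) := by
  have h : S.d b ∈ S.r '' S.invSet B := ⟨S.inv b, mem_image_of_mem _ hb, S.r_inv b⟩
  rw [actOn, indicator_of_mem h, invSet_invSet, S.piMap_d hB hb]

@[simp]
theorem actOn_zero (B : Set G) : S.actOn B (0 : G → R) = 0 := by
  funext u
  simp [actOn]

/-- The coefficient `π_B(π_{B⁻¹}(a) b)` of the product `(a δ_B)(b δ_D)`. -/
noncomputable def skewCoeff (B : Set G) (a b : G → R) : G → R :=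
  S.actOn B (S.actOn (S.invSet B) a * b)

@[simp]
theorem skewCoeff_zero_left (B : Set G) (b : G → R) : S.skewCoeff B 0 b = 0 := by
  simp [skewCoeff]

@[simp]
theorem skewCoeff_zero_right (B : Set G) (a : G → R) : S.skewCoeff B a 0 = 0 := by
  simp [skewCoeff]

theorem skewCoeff_r {B : Set G} (hB : S.IsBisection B) (a b : G → R) {u v : G}
    (hu : u ∈ B) (huv : S.d u = S.r v) :
    S.skewCoeff B a b (S.r u) = a (S.r u) * b (S.r v) := by
  rw [skewCoeff, S.actOn_r hB.2 hu, Pi.mul_apply, S.actOn_invSet_d hB.1 hu, huv]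

theorem deltaEl_self (B : Set G) (a : G → R) : S.deltaEl B a B = a := by
  simp [deltaEl]

theorem deltaEl_of_ne {B C : Set G} (h : C ≠ B) (a : G → R) : S.deltaEl B a C = 0 := by
  simp [deltaEl, h]

theorem deltaEl_eq_single [DecidableEq (Set G)] (B : Set G) (a : G → R) :
    S.deltaEl B a = Pi.single B a := by
  funext C
  by_cases h : C = B
  · subst h; simp [deltaEl_self]
  · simp [S.deltaEl_of_ne h, h]

theorem deltaEl_add (B : Set G) (a b : G → R) :
    S.deltaEl B (a + b) = S.deltaEl B a + S.deltaEl B b := by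
  classical
  simp only [deltaEl_eq_single, Pi.single_add]

theorem deltaEl_mem_finSuppOn {P : Set G → Prop} {B : Set G} (hB : P B) (a : G → R) :
    S.deltaEl B a ∈ finSuppOn (M := G → R) P := by
  refine ⟨(finite_singleton B).subset fun C hC => ?_, fun C hC => ?_⟩
  · by_contra h
    exact hC (S.deltaEl_of_ne h a)
  · obtain rfl : C = B := by
      by_contra h
      exact hC (S.deltaEl_of_ne h a)
    exact hB

/-- A finitely supported family is the sum of its homogeneous pieces. -/
theorem sum_deltaEl {F : Set G → G → R} (hF : (support F).Finite) :
    ∑ B ∈ hF.toFinset, S.deltaEl B (F B) = F := by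
  classical
  funext C
  simp only [Finset.sum_apply, deltaEl_eq_single]
  rw [Finset.sum_pi_single]
  split_ifs with h
  · rfl
  · simpa using Eq.symm (not_not.1 fun h' => h (hF.mem_toFinset.2 h'))

/-- The evaluation map `a δ_B ↦ 1_B · (a ∘ r)`. -/
noncomputable def evalMap (F : Set G → G → R) : G → R :=
  fun x => ∑ᶠ B : Set G, B.indicator (fun y => F B (S.r y)) x

theorem support_evalMap_term (F : Set G → G → R) (x : G) :
    (support fun B : Set G => B.indicator (fun y => F B (S.r y)) x) ⊆ support F := by
  intro B hB h
  exact hB (by simp [h])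

theorem evalMap_add {F F' : Set G → G → R} (hF : (support F).Finite)
    (hF' : (support F').Finite) : S.evalMap (F + F') = S.evalMap F + S.evalMap F' := by
  funext x
  rw [Pi.add_apply, evalMap, evalMap, evalMap,
    ← finsum_add_distrib (hF.subset (S.support_evalMap_term F x))
      (hF'.subset (S.support_evalMap_term F' x))]
  refine finsum_congr fun B => ?_
  by_cases h : x ∈ B <;> simp [h]

theorem evalMap_neg (F : Set G → G → R) : S.evalMap (-F) = -S.evalMap F := by
  funext x
  rw [Pi.neg_apply, evalMap, evalMap, ← finsum_neg_distrib]
  refine finsum_congr fun B => ?_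
  by_cases h : x ∈ B <;> simp [h]

theorem evalMap_sub {F F' : Set G → G → R} (hF : (support F).Finite)
    (hF' : (support F').Finite) : S.evalMap (F - F') = S.evalMap F - S.evalMap F' := by
  rw [sub_eq_add_neg, S.evalMap_add hF (by simpa [support_neg] using hF'), evalMap_neg,
    sub_eq_add_neg]

theorem evalMap_zero : S.evalMap (0 : Set G → G → R) = 0 := by
  funext x
  simp [evalMap]

theorem evalMap_smul (t : R) {F : Set G → G → R} (hF : (support F).Finite) :
    S.evalMap (t • F) = t • S.evalMap F := by
  funext x
  rw [Pi.smul_apply, evalMap, evalMap, smul_eq_mul,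
    mul_finsum' _ t (hF.subset (S.support_evalMap_term F x))]
  refine finsum_congr fun B => ?_
  by_cases h : x ∈ B <;> simp [h]

theorem evalMap_deltaEl (B : Set G) (a : G → R) :
    S.evalMap (S.deltaEl B a) = B.indicator fun y => a (S.r y) := by
  funext x
  rw [evalMap, finsum_eq_single _ B fun C hC => by simp [S.deltaEl_of_ne hC], deltaEl_self]

theorem evalMap_sum {ι : Type*} (s : Finset ι) (F : ι → Set G → G → R)
    (hF : ∀ i ∈ s, (support (F i)).Finite) :
    S.evalMap (∑ i ∈ s, F i) = ∑ i ∈ s, S.evalMap (F i) := by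
  classical
  induction s using Finset.induction_on with
  | empty => simpa using S.evalMap_zero
  | insert i s hi ih =>
    have hs : ∀ j ∈ s, F j ∈ finSuppOn (M := G → R) fun _ : Set G => True :=
      fun j hj => ⟨hF j (Finset.mem_insert_of_mem hj), fun _ _ => trivial⟩
    rw [Finset.sum_insert hi, Finset.sum_insert hi,
      S.evalMap_add (hF i (Finset.mem_insert_self i s)) (sum_mem hs).1,
      ih fun j hj => hF j (Finset.mem_insert_of_mem hj)]

theorem evalMap_eq_sum {F : Set G → G → R} (hF : (support F).Finite) :
    S.evalMap F = ∑ B ∈ hF.toFinset, B.indicator fun y => F B (S.r y) := by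
  conv_lhs => rw [← S.sum_deltaEl hF]
  rw [S.evalMap_sum _ _ fun B _ => (S.deltaEl_mem_finSuppOn (P := fun _ => True) trivial _).1]
  simp only [evalMap_deltaEl]

theorem skewMul_eq_sum {F F' : Set G → G → R} (hF : (support F).Finite)
    (hF' : (support F').Finite) :
    S.skewMul F F' = ∑ p ∈ hF.toFinset ×ˢ hF'.toFinset,
      S.deltaEl (S.setMul p.1 p.2) (S.skewCoeff p.1 (F p.1) (F' p.2)) := by
  classical
  funext C
  rw [Finset.sum_apply, skewMul, finsum_mem_def, finsum_eq_sum_of_support_subset]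
  · refine Finset.sum_congr rfl fun p _ => ?_
    by_cases h : S.setMul p.1 p.2 = C
    · rw [indicator_of_mem (show p ∈ {p : Set G × Set G | S.setMul p.1 p.2 = C} from h), ← h,
        deltaEl_self, skewCoeff]
    · rw [indicator_of_notMem (show p ∉ {p : Set G × Set G | S.setMul p.1 p.2 = C} from h),
        S.deltaEl_of_ne (Ne.symm h)]
  · intro p hp
    have hp' := mem_of_indicator_ne_zero hp
    rw [mem_support, indicator_of_mem hp'] at hp
    simp only [Finset.coe_product, Finite.coe_toFinset, mem_prod, mem_support]
    constructor
    · intro h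
      exact hp (by rw [h]; exact S.skewCoeff_zero_left p.1 _)
    · intro h
      exact hp (by rw [h]; exact S.skewCoeff_zero_right p.1 _)

theorem skewMul_mem {F F' : Set G → G → R} (hF : F ∈ finSuppOn (M := G → R) S.IsBisection)
    (hF' : F' ∈ finSuppOn (M := G → R) S.IsBisection) :
    S.skewMul F F' ∈ finSuppOn (M := G → R) S.IsBisection := by
  rw [S.skewMul_eq_sum hF.1 hF'.1]
  refine sum_mem fun p hp => S.deltaEl_mem_finSuppOn ?_ _
  rw [Finset.mem_product, Finite.mem_toFinset, Finite.mem_toFinset] at hp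
  exact (hF.2 _ hp.1).setMul (hF'.2 _ hp.2)

/-- The factorizations of `x` as a product of two elements of `G`. -/
def factorizations (x : G) : Set (G × G) := {p | S.d p.1 = S.r p.2 ∧ S.mul p.1 p.2 = x}

theorem factorizations_inter_prod_subsingleton {B D : Set G} (hB : S.IsBisection B)
    (hD : S.IsBisection D) (x : G) : (S.factorizations x ∩ B ×ˢ D).Subsingleton := by
  rintro ⟨u, v⟩ ⟨⟨h, hx⟩, hu, hv⟩ ⟨u', v'⟩ ⟨⟨h', hx'⟩, hu', hv'⟩
  simp only at h h' hx hx' hu hv hu' hv'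
  have hr := S.r_mul' h
  have hr' := S.r_mul' h'
  have hd := S.d_mul h
  have hd' := S.d_mul h'
  rw [hx] at hr hd
  rw [hx'] at hr' hd'
  rw [hB.2 hu hu' (hr.symm.trans hr'), hD.1 hv hv' (hd.symm.trans hd')]

theorem support_conv_term (B D : Set G) (f g : G → R) (x : G) :
    (support ((S.factorizations x).indicator fun p : G × G =>
      B.indicator f p.1 * D.indicator g p.2)) ⊆ S.factorizations x ∩ B ×ˢ D := by
  intro p hp
  have hx := mem_of_indicator_ne_zero hp
  rw [mem_support, indicator_of_mem hx] at hp
  exact ⟨hx, mem_of_indicator_ne_zero (left_ne_zero_of_mul hp),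
    mem_of_indicator_ne_zero (right_ne_zero_of_mul hp)⟩

theorem conv_indicator {B D : Set G} (hB : S.IsBisection B) (hD : S.IsBisection D)
    (a b : G → R) (x : G) :
    ∑ᶠ p, (S.factorizations x).indicator (fun p : G × G =>
        B.indicator (fun y => a (S.r y)) p.1 * D.indicator (fun y => b (S.r y)) p.2) p =
      (S.setMul B D).indicator (fun y => S.skewCoeff B a b (S.r y)) x := by
  by_cases hx : x ∈ S.setMul B D
  · obtain ⟨u, hu, v, hv, huv, rfl⟩ := id hx
    have hmem : (u, v) ∈ S.factorizations (S.mul u v) := ⟨huv, rfl⟩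
    rw [finsum_eq_single _ (u, v), indicator_of_mem hmem, indicator_of_mem hx,
      indicator_of_mem hu, indicator_of_mem hv, S.r_mul' huv, S.skewCoeff_r hB a b hu huv]
    intro p hp
    by_contra h
    exact hp (S.factorizations_inter_prod_subsingleton hB hD _
      (S.support_conv_term B D _ _ _ h) ⟨hmem, hu, hv⟩)
  · rw [indicator_of_notMem hx]
    refine finsum_eq_zero_of_forall_eq_zero fun p => ?_
    by_contra h
    obtain ⟨⟨hp, hpx⟩, hpB, hpD⟩ := S.support_conv_term B D _ _ _ h
    exact hx ⟨p.1, hpB, p.2, hpD, hp, hpx.symm⟩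

theorem evalMap_skewMul [TopologicalSpace G] {F F' : Set G → G → R}
    (hF : F ∈ finSuppOn (M := G → R) S.IsBisection)
    (hF' : F' ∈ finSuppOn (M := G → R) S.IsBisection) :
    S.evalMap (S.skewMul F F') = S.conv (S.evalMap F) (S.evalMap F') := by
  classical
  rw [S.skewMul_eq_sum hF.1 hF'.1, S.evalMap_sum _ _ fun p _ =>
    (S.deltaEl_mem_finSuppOn (P := fun _ => True) trivial _).1,
    S.evalMap_eq_sum hF.1, S.evalMap_eq_sum hF'.1]
  simp only [evalMap_deltaEl]
  funext x
  have hbis : ∀ p ∈ hF.1.toFinset ×ˢ hF'.1.toFinset,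
      S.IsBisection p.1 ∧ S.IsBisection p.2 := fun p hp => by
    rw [Finset.mem_product, Finite.mem_toFinset, Finite.mem_toFinset] at hp
    exact ⟨hF.2 _ hp.1, hF'.2 _ hp.2⟩
  calc _ = ∑ q ∈ hF.1.toFinset ×ˢ hF'.1.toFinset, ∑ᶠ p,
        (S.factorizations x).indicator (fun p : G × G =>
          q.1.indicator (fun y => F q.1 (S.r y)) p.1 *
            q.2.indicator (fun y => F' q.2 (S.r y)) p.2) p := by
        rw [Finset.sum_apply]
        exact Finset.sum_congr rfl fun q hq =>
          (S.conv_indicator (hbis q hq).1 (hbis q hq).2 _ _ x).symm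
    _ = ∑ᶠ p, ∑ q ∈ hF.1.toFinset ×ˢ hF'.1.toFinset,
        (S.factorizations x).indicator (fun p : G × G =>
          q.1.indicator (fun y => F q.1 (S.r y)) p.1 *
            q.2.indicator (fun y => F' q.2 (S.r y)) p.2) p :=
        (finsum_sum_comm _ _ fun q hq =>
          (S.factorizations_inter_prod_subsingleton (hbis q hq).1 (hbis q hq).2 x).finite.subset
            (S.support_conv_term q.1 q.2 _ _ x)).symm
    _ = _ := by
        rw [conv, finsum_mem_def]
        refine finsum_congr fun p => ?_
        change _ = (S.factorizations x).indicator _ p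
        by_cases hp : p ∈ S.factorizations x
        · simp only [indicator_of_mem hp, Finset.sum_apply]
          rw [Finset.sum_mul_sum, Finset.sum_product]
        · simp only [indicator_of_notMem hp, Finset.sum_const_zero]

theorem conv_zero_left [TopologicalSpace G] (g : G → R) : S.conv 0 g = 0 := by
  funext x
  simp [conv]

theorem conv_zero_right [TopologicalSpace G] (f : G → R) : S.conv f 0 = 0 := by
  funext x
  simp [conv]

end Algebra

section Topology

variable {G : Type*} [TopologicalSpace G] (S : GroupoidStr G) {R : Type*} [CommRing R]
  {Γ : Type*} (c : G → Γ)

variable {S c}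

theorem IsHomCOB.isBisection {B : Set G} (hB : S.IsHomCOB c B) : S.IsBisection B :=
  ⟨hB.1.2.2.1, hB.1.2.2.2.1⟩

theorem IsHomCOB.isOpen_r_image {B V : Set G} (hB : S.IsHomCOB c B) (hV : V ⊆ B)
    (hVo : IsOpen V) : IsOpen (S.r '' V) := hB.1.2.2.2.2.2 V hV hVo

theorem IsHomCOB.isClopen [T2Space G] {B : Set G} (hB : S.IsHomCOB c B) : IsClopen B :=
  ⟨hB.1.1.isClosed, hB.1.2.1⟩

theorem IsHomCOB.of_subset {B V : Set G} (hB : S.IsHomCOB c B) (hV : V ⊆ B)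
    (hVc : IsClopen V) : S.IsHomCOB c V := by
  obtain ⟨⟨hBc, hBo, hBd, hBr, hd, hr⟩, γ, hγ⟩ := hB
  exact ⟨⟨hBc.of_isClosed_subset hVc.1 hV, hVc.2, hBd.mono hV, hBr.mono hV,
    fun W hW => hd W (hW.trans hV), fun W hW => hr W (hW.trans hV)⟩, γ, hV.trans hγ⟩

theorem IsTopological.continuous_r (hS : S.IsTopological) : Continuous S.r := by
  have h : Continuous fun x : G =>
      (⟨(x, S.inv x), (S.r_inv x).symm⟩ : {p : G × G // S.d p.1 = S.r p.2}) :=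
    (continuous_id.prodMk hS.1).subtype_mk _
  exact hS.2.comp h

theorem IsHomCOB.isClopen_r_image [T2Space G] (hS : S.IsTopological) {B : Set G}
    (hB : S.IsHomCOB c B) : IsClopen (S.r '' B) :=
  ⟨(hB.1.1.image hS.continuous_r).isClosed, hB.isOpen_r_image Subset.rfl hB.1.2.1⟩

theorem _root_.IsLocallyConstant.indicator_of_isClopen {X M : Type*} [TopologicalSpace X]
    [Zero M] {f : X → M} (hf : IsLocallyConstant f) {U : Set X} (hU : IsClopen U) :
    IsLocallyConstant (U.indicator f) := by
  classical
  intro s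
  rw [indicator_preimage]
  exact IsOpen.ite' (hf s) (IsLocallyConstant.const (0 : M) s) (by simp [hU.frontier_eq])

theorem steinSet_of_support_subset [T2Space G] {f : G → R} (hf : IsLocallyConstant f)
    {K : Set G} (hK : IsCompact K) (h : ∀ x, f x ≠ 0 → x ∈ K) : f ∈ S.SteinSet R :=
  ⟨hf, HasCompactSupport.intro hK fun x hx => not_not.1 fun h' => hx (h x h')⟩

theorem coeffOK_of_support_subset [T2Space G] (hS : S.IsTopological) {B : Set G}
    (hB : S.IsHomCOB c B) {a : G → R} (ha : IsLocallyConstant a)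
    (h : ∀ x, a x ≠ 0 → x ∈ S.r '' B) : S.coeffOK B a :=
  ⟨steinSet_of_support_subset ha (hB.1.1.image hS.continuous_r) h, h⟩

theorem add_mem_steinSet {f g : G → R} (hf : f ∈ S.SteinSet R) (hg : g ∈ S.SteinSet R) :
    f + g ∈ S.SteinSet R := ⟨hf.1.add hg.1, hf.2.add hg.2⟩

theorem zero_mem_steinSet : (0 : G → R) ∈ S.SteinSet R :=
  ⟨IsLocallyConstant.const 0, HasCompactSupport.zero⟩

theorem coeffOK_zero (B : Set G) : S.coeffOK B (0 : G → R) :=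
  ⟨zero_mem_steinSet, fun _ h => (h rfl).elim⟩

theorem coeffOK.add {B : Set G} {a b : G → R} (ha : S.coeffOK B a) (hb : S.coeffOK B b) :
    S.coeffOK B (a + b) := by
  refine ⟨add_mem_steinSet ha.1 hb.1, fun x hx => ?_⟩
  by_cases h : a x = 0
  · exact hb.2 x fun h' => hx (by simp [h, h'])
  · exact ha.2 x h

theorem coeffOK.neg {B : Set G} {a : G → R} (ha : S.coeffOK B a) : S.coeffOK B (-a) :=
  ⟨⟨ha.1.1.neg, ha.1.2.neg⟩, fun x hx => ha.2 x (by simpa using hx)⟩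

variable (S c R)

/-- `LSet` as an additive group. -/
def skewRing : AddSubgroup (Set G → G → R) where
  carrier := S.LSet c
  zero_mem' := by simp [LSet]
  add_mem' := by
    rintro F F' ⟨hF, hP⟩ ⟨hF', hP'⟩
    refine ⟨(hF.union hF').subset (support_add F F'), fun B hB => ?_⟩
    by_cases h : F B = 0
    · have h' : F' B ≠ 0 := fun h' => hB (by simp [h, h'])
      simpa [h] using hP' B h'
    · refine ⟨(hP B h).1, (hP B h).2.add ?_⟩
      by_cases h' : F' B = 0
      · rw [h']
        exact coeffOK_zero B
      · exact (hP' B h').2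
  neg_mem' := by
    rintro F ⟨hF, hP⟩
    have h : ∀ B, (-F) B ≠ 0 → F B ≠ 0 := fun B hB => by simpa using hB
    exact ⟨hF.subset h, fun B hB => ⟨(hP B (h B hB)).1, (hP B (h B hB)).2.neg⟩⟩

variable {S c R}

theorem mem_finSuppOn_of_mem_LSet {F : Set G → G → R} (hF : F ∈ S.LSet c) :
    F ∈ finSuppOn (M := G → R) S.IsBisection :=
  ⟨hF.1, fun B hB => (hF.2 B hB).1.isBisection⟩

theorem deltaEl_mem_LSet {B : Set G} (hB : S.IsHomCOB c B) {a : G → R} (ha : S.coeffOK B a) :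
    S.deltaEl B a ∈ S.LSet c := by
  obtain ⟨h, h'⟩ := S.deltaEl_mem_finSuppOn (P := fun C => C = B) rfl a
  refine ⟨h, fun C hC => ?_⟩
  obtain rfl := h' C hC
  rw [deltaEl_self]
  exact ⟨hB, ha⟩

theorem evalMap_mem_steinSet [T2Space G] (hS : S.IsTopological) {F : Set G → G → R}
    (hF : F ∈ S.LSet c) : S.evalMap F ∈ S.SteinSet R := by
  rw [S.evalMap_eq_sum hF.1]
  refine Finset.sum_induction _ (fun f => f ∈ S.SteinSet R) (fun _ _ => add_mem_steinSet)
    zero_mem_steinSet fun B hB => ?_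
  obtain ⟨hB, ha⟩ := hF.2 B ((hF.1.mem_toFinset).1 hB)
  exact steinSet_of_support_subset
    ((ha.1.1.comp_continuous hS.continuous_r).indicator_of_isClopen hB.isClopen) hB.1.1
    fun x hx => mem_of_indicator_ne_zero hx

/-- A locally constant function supported on a bisection `B` is the evaluation of some
`a δ_B`. -/
theorem exists_coeffOK_evalMap_eq [T2Space G] (hS : S.IsTopological) {B : Set G}
    (hB : S.IsHomCOB c B) {f : G → R} (hf : IsLocallyConstant f) :
    ∃ a, S.coeffOK B a ∧ S.evalMap (S.deltaEl B a) = B.indicator f := by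
  classical
  let a : G → R := fun u => if h : ∃ b ∈ B, S.r b = u then f h.choose else 0
  have har : ∀ b ∈ B, a (S.r b) = f b := fun b hb => by
    have h : ∃ b' ∈ B, S.r b' = S.r b := ⟨b, hb, rfl⟩
    simp only [a, dif_pos h]
    rw [hB.isBisection.2 h.choose_spec.1 hb h.choose_spec.2]
  have ha0 : ∀ u, u ∉ S.r '' B → a u = 0 := fun u hu => dif_neg hu
  refine ⟨a, coeffOK_of_support_subset hS hB (fun s => ?_) fun u hu => ?_, ?_⟩
  · have key : a ⁻¹' s =
        S.r '' (B ∩ f ⁻¹' s) ∪ ((S.r '' B)ᶜ ∩ (fun _ : G => (0 : R)) ⁻¹' s) := by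
      ext u
      by_cases hu : u ∈ S.r '' B
      · obtain ⟨b, hb, rfl⟩ := id hu
        simp only [mem_preimage, har b hb, mem_union, mem_inter_iff, mem_compl_iff, hu,
          not_true_eq_false, false_and, or_false]
        refine ⟨fun h => ⟨b, ⟨hb, h⟩, rfl⟩, ?_⟩
        rintro ⟨b', ⟨hb', h⟩, hbb'⟩
        rwa [← hB.isBisection.2 hb' hb hbb']
      · have h : u ∉ S.r '' (B ∩ f ⁻¹' s) := fun h => hu (image_mono inter_subset_left h)
        simp [ha0 u hu, h, hu]
    rw [key]
    exact (hB.isOpen_r_image inter_subset_left (hB.isClopen.2.inter (hf s))).union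
      ((hB.isClopen_r_image hS).compl.2.inter (IsLocallyConstant.const (0 : R) s))
  · by_contra h
    exact hu (ha0 u h)
  · rw [evalMap_deltaEl]
    exact indicator_congr har

theorem exists_LSet_evalMap_eq_of_subset [T2Space G] (hS : S.IsTopological)
    (T : Finset (Set G)) (hT : ∀ B ∈ T, S.IsHomCOB c B) {f : G → R}
    (hf : IsLocallyConstant f) (hfT : ∀ x, f x ≠ 0 → ∃ B ∈ T, x ∈ B) :
    ∃ F ∈ S.LSet c, S.evalMap F = f := by
  classical
  induction T using Finset.induction_on generalizing f with
  | empty =>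
    refine ⟨0, (S.skewRing R c).zero_mem, ?_⟩
    rw [evalMap_zero]
    funext x
    by_contra h
    simpa using hfT x (Ne.symm h)
  | insert B T _ ih =>
    have hB := hT B (Finset.mem_insert_self B T)
    obtain ⟨a, ha, hae⟩ := exists_coeffOK_evalMap_eq hS hB hf
    obtain ⟨F, hF, hFe⟩ := ih (fun C hC => hT C (Finset.mem_insert_of_mem hC))
      (hf.indicator_of_isClopen hB.isClopen.compl) fun x hx => by
        have hxB := mem_of_indicator_ne_zero hx
        rw [indicator_of_mem hxB] at hx
        obtain ⟨C, hC, hxC⟩ := hfT x hx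
        rcases Finset.mem_insert.1 hC with rfl | hC
        · exact (hxB hxC).elim
        · exact ⟨C, hC, hxC⟩
    have hδ := deltaEl_mem_LSet hB ha
    refine ⟨_, (S.skewRing R c).add_mem hδ hF, ?_⟩
    rw [S.evalMap_add hδ.1 hF.1, hae, hFe, indicator_self_add_compl]

theorem exists_LSet_evalMap_eq [T2Space G] (hS : S.IsTopological) (hAmple : S.IsAmple)
    (hc : ∀ γ : Γ, IsOpen (c ⁻¹' {γ})) {f : G → R} (hf : f ∈ S.SteinSet R) :
    ∃ F ∈ S.LSet c, S.evalMap F = f := by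
  choose U hxU hUc hUk hU using fun x : G => hAmple x (c ⁻¹' {c x}) rfl (hc (c x))
  obtain ⟨t, ht⟩ := hf.2.isCompact.elim_finite_subcover U (fun x => (hU x).1)
    fun x _ => mem_iUnion.2 ⟨x, hxU x⟩
  classical
  refine exists_LSet_evalMap_eq_of_subset hS (t.image U) (fun B hB => ?_) hf.1 fun x hx => ?_
  · obtain ⟨x, _, rfl⟩ := Finset.mem_image.1 hB
    exact ⟨⟨hUk x, hU x⟩, c x, hUc x⟩
  · obtain ⟨y, hy, hxy⟩ := mem_iUnion₂.1 (ht (subset_tsupport f hx))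
    exact ⟨U y, Finset.mem_image_of_mem U hy, hxy⟩

theorem mem_finSuppOn_and_evalMap_eq_zero_of_mem_relGen {g : Set G → G → R}
    (hg : g ∈ S.relGen c) :
    g ∈ finSuppOn (M := G → R) S.IsBisection ∧ S.evalMap g = 0 := by
  obtain ⟨B, C, a, hBC, hB, hC, ha, rfl⟩ := hg
  have h1 := S.deltaEl_mem_finSuppOn hB.isBisection a
  have h2 := S.deltaEl_mem_finSuppOn hC.isBisection a
  refine ⟨sub_mem h1 h2, ?_⟩
  rw [S.evalMap_sub h1.1 h2.1, evalMap_deltaEl, evalMap_deltaEl, sub_eq_zero]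
  funext x
  by_cases hxB : x ∈ B
  · rw [indicator_of_mem hxB, indicator_of_mem (hBC hxB)]
  · rw [indicator_of_notMem hxB]
    by_cases hxC : x ∈ C
    · rw [indicator_of_mem hxC]
      by_contra h
      obtain ⟨b, hb, hbx⟩ := ha.2 _ (Ne.symm h)
      exact hxB (hC.isBisection.2 (hBC hb) hxC hbx ▸ hb)
    · rw [indicator_of_notMem hxC]

theorem evalMap_eq_zero_of_mem_NSet {F : Set G → G → R} (hF : F ∈ S.NSet c) :
    S.evalMap F = 0 := by
  have key : F ∈ finSuppOn (M := G → R) S.IsBisection ∧ S.evalMap F = 0 := by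
    refine AddSubgroup.closure_induction (p := fun F _ =>
      F ∈ finSuppOn (M := G → R) S.IsBisection ∧ S.evalMap F = 0) ?_ ?_ ?_ ?_ hF
    · rintro F ⟨g, hg, h⟩
      obtain ⟨hg, hg0⟩ := mem_finSuppOn_and_evalMap_eq_zero_of_mem_relGen hg
      rcases h with rfl | ⟨X, hX, rfl⟩ | ⟨Y, hY, rfl⟩ | ⟨X, hX, Y, hY, rfl⟩
      · exact ⟨hg, hg0⟩
      · have hX := mem_finSuppOn_of_mem_LSet hX
        exact ⟨S.skewMul_mem hX hg, by rw [S.evalMap_skewMul hX hg, hg0, conv_zero_right]⟩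
      · have hY := mem_finSuppOn_of_mem_LSet hY
        exact ⟨S.skewMul_mem hg hY, by rw [S.evalMap_skewMul hg hY, hg0, conv_zero_left]⟩
      · have hX := mem_finSuppOn_of_mem_LSet hX
        have hY := mem_finSuppOn_of_mem_LSet hY
        have hXg := S.skewMul_mem hX hg
        exact ⟨S.skewMul_mem hXg hY, by
          rw [S.evalMap_skewMul hXg hY, S.evalMap_skewMul hX hg, hg0, conv_zero_right,
            conv_zero_left]⟩
    · exact ⟨zero_mem _, S.evalMap_zero⟩
    · rintro F F' _ _ ⟨hF, h⟩ ⟨hF', h'⟩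
      exact ⟨add_mem hF hF', by rw [S.evalMap_add hF.1 hF'.1, h, h', add_zero]⟩
    · rintro F _ ⟨hF, h⟩
      exact ⟨neg_mem hF, by rw [evalMap_neg, h, neg_zero]⟩
  exact key.2

variable (S c R)

/-- `NSet` as an additive group. -/
def relIdeal : AddSubgroup (Set G → G → R) :=
  AddSubgroup.closure
    {F | ∃ g ∈ S.relGen c, F = g ∨ (∃ X ∈ S.LSet c, F = S.skewMul X g) ∨
      (∃ Y ∈ S.LSet c, F = S.skewMul g Y) ∨
      (∃ X ∈ S.LSet c, ∃ Y ∈ S.LSet c, F = S.skewMul (S.skewMul X g) Y)}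

variable {S c R}

theorem deltaEl_sub_deltaEl_mem_relIdeal {B C : Set G} {a : G → R} (hBC : B ⊆ C)
    (hB : S.IsHomCOB c B) (hC : S.IsHomCOB c C) (ha : S.coeffOK B a) :
    S.deltaEl B a - S.deltaEl C a ∈ S.relIdeal R c :=
  AddSubgroup.subset_closure ⟨_, ⟨B, C, a, hBC, hB, hC, ha, rfl⟩, Or.inl rfl⟩

/-- If `a ∘ r` vanishes on the part of `B` not covered by `T`, then `a δ_B` can be rewritten
modulo `N` as a combination of `δ_C` with `C ∈ T`. -/
theorem exists_deltaEl_sub_mem_relIdeal [T2Space G] (hS : S.IsTopological) {B : Set G}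
    (hB : S.IsHomCOB c B) (T : Finset (Set G)) (hT : ∀ C ∈ T, S.IsHomCOB c C) {a : G → R}
    (ha : S.coeffOK B a) (haT : ∀ x ∈ B, a (S.r x) ≠ 0 → ∃ C ∈ T, x ∈ C) :
    ∃ F ∈ S.LSet c, (∀ C, F C ≠ 0 → C ∈ T) ∧ S.deltaEl B a - F ∈ S.relIdeal R c := by
  classical
  induction T using Finset.induction_on generalizing a with
  | empty =>
    have h0 : a = 0 := by
      funext u
      by_contra h
      obtain ⟨x, hx, rfl⟩ := ha.2 u h
      simpa using haT x hx h
    refine ⟨0, (S.skewRing R c).zero_mem, fun C hC => (hC rfl).elim, ?_⟩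
    rw [h0, deltaEl_eq_single, Pi.single_zero, sub_zero]
    exact zero_mem _
  | insert C T _ ih =>
    have hC := hT C (Finset.mem_insert_self C T)
    have hE : S.IsHomCOB c (B ∩ C) :=
      hB.of_subset inter_subset_left (hB.isClopen.inter hC.isClopen)
    have hr := hE.isClopen_r_image hS
    set a₁ := (S.r '' (B ∩ C)).indicator a with ha₁
    set a₂ := (S.r '' (B ∩ C))ᶜ.indicator a with ha₂
    have haa : a₁ + a₂ = a := indicator_self_add_compl _ _
    have hE₁ : S.coeffOK (B ∩ C) a₁ := coeffOK_of_support_subset hS hE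
      (ha.1.1.indicator_of_isClopen hr) fun x hx => mem_of_indicator_ne_zero hx
    have hC₁ : S.coeffOK C a₁ := ⟨hE₁.1, fun x hx => image_mono inter_subset_right (hE₁.2 x hx)⟩
    have hB₂ : S.coeffOK B a₂ := coeffOK_of_support_subset hS hB
      (ha.1.1.indicator_of_isClopen hr.compl) fun x hx => ha.2 x fun h => hx (by
        by_cases hx' : x ∈ (S.r '' (B ∩ C))ᶜ <;> simp [ha₂, h])
    obtain ⟨F, hF, hFT, hFN⟩ := ih (fun D hD => hT D (Finset.mem_insert_of_mem hD)) hB₂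
      fun x hx hax => by
        have hxE := mem_of_indicator_ne_zero hax
        rw [ha₂, indicator_of_mem hxE] at hax
        obtain ⟨D, hD, hxD⟩ := haT x hx hax
        rcases Finset.mem_insert.1 hD with rfl | hD
        · exact (hxE ⟨x, ⟨hx, hxD⟩, rfl⟩).elim
        · exact ⟨D, hD, hxD⟩
    refine ⟨S.deltaEl C a₁ + F, (S.skewRing R c).add_mem (deltaEl_mem_LSet hC hC₁) hF,
      fun D hD => ?_, ?_⟩
    · by_cases h : D = C
      · exact h ▸ Finset.mem_insert_self C T
      · rw [Pi.add_apply, S.deltaEl_of_ne h, zero_add] at hD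
        exact Finset.mem_insert_of_mem (hFT D hD)
    · have h₁ := deltaEl_sub_deltaEl_mem_relIdeal inter_subset_left hE hB hE₁
      have h₂ := deltaEl_sub_deltaEl_mem_relIdeal inter_subset_right hE hC hE₁
      have h := add_mem (sub_mem h₂ h₁) hFN
      rw [← haa, deltaEl_add]
      convert h using 1
      abel

theorem mem_relIdeal_of_evalMap_eq_zero [T2Space G] (hS : S.IsTopological)
    (T : Finset (Set G)) (hT : ∀ B ∈ T, S.IsHomCOB c B) {F : Set G → G → R}
    (hF : F ∈ S.LSet c) (hFT : ∀ B, F B ≠ 0 → B ∈ T) (h0 : S.evalMap F = 0) :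
    F ∈ S.relIdeal R c := by
  classical
  induction T using Finset.induction_on generalizing F with
  | empty =>
    have h : F = 0 := by
      funext B
      by_contra h
      simpa using hFT B h
    exact h ▸ zero_mem _
  | insert B T hBT ih =>
    have hB := hT B (Finset.mem_insert_self B T)
    have hT' : ∀ C ∈ T, S.IsHomCOB c C := fun C hC => hT C (Finset.mem_insert_of_mem hC)
    have ha : S.coeffOK B (F B) := by
      by_cases h : F B = 0
      · rw [h]
        exact coeffOK_zero B
      · exact (hF.2 B h).2
    obtain ⟨F', hF', hFT', hN⟩ := exists_deltaEl_sub_mem_relIdeal hS hB T hT' ha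
      fun x hx hax => by
        by_contra! h
        refine hax ?_
        have hx0 := congrFun h0 x
        rwa [evalMap, finsum_eq_single _ B, indicator_of_mem hx] at hx0
        intro C hC
        by_contra hCx
        have hCF := S.support_evalMap_term F x hCx
        exact h C (Finset.mem_of_mem_insert_of_ne (hFT C hCF) hC)
          (mem_of_indicator_ne_zero hCx)
    have hδ := deltaEl_mem_LSet hB ha
    have hD : S.deltaEl B (F B) - F' ∈ S.LSet c := (S.skewRing R c).sub_mem hδ hF'
    have hL : F - (S.deltaEl B (F B) - F') ∈ S.LSet c := (S.skewRing R c).sub_mem hF hD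
    have key : F - (S.deltaEl B (F B) - F') ∈ S.relIdeal R c := by
      refine ih hT' hL (fun C hC => ?_) ?_
      · by_cases h : C = B
        · subst h
          refine hFT' C fun h' => hC ?_
          simp [deltaEl_self, h']
        · by_cases h' : F' C = 0
          · refine Finset.mem_of_mem_insert_of_ne (hFT C fun h'' => hC ?_) h
            simp [S.deltaEl_of_ne h, h', h'']
          · exact hFT' C h'
      · rw [S.evalMap_sub hF.1 hD.1, h0, evalMap_eq_zero_of_mem_NSet hN, sub_zero]
    simpa using add_mem key hN

end Topology

end GroupoidStr

/-- Let `G` be a `Γ`-graded Hausdorff ample groupoid and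
`π = (π_B, C_R(BB⁻¹), C_R(G⁰))_{B ∈ G^h}` the induced action of `G^h` on `C_R(G⁰)`.
Then `A_R(G) ≅ C_R(G⁰) ⋊_π G^h` as `Γ`-graded `R`-algebras, via the correspondence
`1_D ↦ [1_{r(D)} δ_D]`.  Here the isomorphism is exhibited by the evaluation map
`Φ : L → A_R(G)` which is surjective, multiplicative, additive, `R`-linear, graded,
sends `1_{r(D)} δ_D` to `1_D`, and identifies two elements of `L` exactly when they
differ by an element of the ideal `N` (so that it descends to a graded isomorphism of
`L/N = C_R(G⁰) ⋊_π G^h` onto `A_R(G)`). -/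
theorem steinberg_iso_skew_inverse_semigroup_ring {G : Type*} [TopologicalSpace G]
    (S : GroupoidStr G) [T2Space G] (hTop : S.IsTopological) (hAmple : S.IsAmple)
    {Γ : Type*} [Group Γ] (c : G → Γ)
    (hc_cont : ∀ γ : Γ, IsOpen (c ⁻¹' {γ}))
    (hc_mul : ∀ x y : G, S.d x = S.r y → c (S.mul x y) = c x * c y)
    (R : Type*) [CommRing R] :
    ∃ Φ : (Set G → G → R) → (G → R),
      Set.MapsTo Φ (S.LSet c) (S.SteinSet R) ∧
      Set.SurjOn Φ (S.LSet c) (S.SteinSet R) ∧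
      (∀ F ∈ S.LSet c, ∀ F' ∈ S.LSet c, Φ (F + F') = Φ F + Φ F') ∧
      (∀ F ∈ S.LSet c, ∀ F' ∈ S.LSet c, Φ (S.skewMul F F') = S.conv (Φ F) (Φ F')) ∧
      (∀ (r : R), ∀ F ∈ S.LSet c, Φ (r • F) = r • Φ F) ∧
      (∀ F ∈ S.LSet c, ∀ F' ∈ S.LSet c, (Φ F = Φ F' ↔ F - F' ∈ S.NSet c)) ∧
      (∀ γ : Γ, ∀ F ∈ S.LSet c, (∀ B : Set G, F B ≠ 0 → B ⊆ c ⁻¹' {γ}) →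
        ∀ x : G, Φ F x ≠ 0 → c x = γ) ∧
      (∀ D : Set G, S.IsHomCOB c D →
        Φ (S.deltaEl D ((S.r '' D).indicator fun _ => (1 : R))) =
          D.indicator fun _ => (1 : R)) := by
  refine ⟨S.evalMap, fun F hF => GroupoidStr.evalMap_mem_steinSet hTop hF,
    fun f hf => GroupoidStr.exists_LSet_evalMap_eq hTop hAmple hc_cont hf,
    fun F hF F' hF' => S.evalMap_add hF.1 hF'.1,
    fun F hF F' hF' => S.evalMap_skewMul (GroupoidStr.mem_finSuppOn_of_mem_LSet hF)
      (GroupoidStr.mem_finSuppOn_of_mem_LSet hF'),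
    fun t F hF => S.evalMap_smul t hF.1, fun F hF F' hF' => ?_, fun γ F hF hFγ x hx => ?_,
    fun D hD => ?_⟩
  · have hL : F - F' ∈ S.LSet c := (S.skewRing R c).sub_mem hF hF'
    rw [← sub_eq_zero, ← S.evalMap_sub hF.1 hF'.1]
    refine ⟨fun h => ?_, GroupoidStr.evalMap_eq_zero_of_mem_NSet⟩
    exact GroupoidStr.mem_relIdeal_of_evalMap_eq_zero hTop hL.1.toFinset
      (fun B hB => (hL.2 B (hL.1.mem_toFinset.1 hB)).1) hL
      (fun B hB => hL.1.mem_toFinset.2 hB) h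
  · obtain ⟨B, hB⟩ : ∃ B : Set G, B.indicator (fun y => F B (S.r y)) x ≠ 0 := by
      by_contra! h
      exact hx (finsum_eq_zero_of_forall_eq_zero h)
    exact hFγ B (S.support_evalMap_term F x hB) (mem_of_indicator_ne_zero hB)
  · rw [S.evalMap_deltaEl]
    exact indicator_congr fun x hx => indicator_of_mem (mem_image_of_mem _ hx) _
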